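/- Let n ≥ 3 be an integer, λ ∈ {−1, 1}, t* ∈ ℝ, x* ∈ Eⁿ, and let ψ : ℝ × Eⁿ → ℝ be twice continuously differentiable and satisfy the decay condition at (t*, x*, λ). Then, with a_n = Γ(n/2)/(2(n−2)π^{n/2}), both functions x ↦ ‖x − x*‖^{2−n}·(□ψ)(t* + λ‖x − x*‖, x) and x ↦ ‖x − x*‖^{1−n}·(∂_tψ)(t* + λ‖x − x*‖, x) are Lebesgue integrable on Eⁿ and ψ(t*, x*) = −a_n·∫_{Eⁿ} ‖x − x*‖^{2−n}·(□ψ)(t* + λ‖x − x*‖, x) dx − λ(n−3)·a_n·∫_{Eⁿ} ‖x − x*‖^{1−n}·(∂_tψ)(t* + λ‖x − x*‖, x) dx. -/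

import Mathlib

open MeasureTheory Real Filter

noncomputable def pd {n : ℕ} (i : Fin n) (f : EuclideanSpace ℝ (Fin n) → ℝ)
    (x : EuclideanSpace ℝ (Fin n)) : ℝ :=
  fderiv ℝ f x (EuclideanSpace.single i 1)

noncomputable def pdT {n : ℕ} (ψ : ℝ × EuclideanSpace ℝ (Fin n) → ℝ)
    (p : ℝ × EuclideanSpace ℝ (Fin n)) : ℝ :=
  deriv (fun s => ψ (s, p.2)) p.1

noncomputable def pdX {n : ℕ} (i : Fin n) (ψ : ℝ × EuclideanSpace ℝ (Fin n) → ℝ)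
    (p : ℝ × EuclideanSpace ℝ (Fin n)) : ℝ :=
  fderiv ℝ (fun y => ψ (p.1, y)) p.2 (EuclideanSpace.single i 1)

noncomputable def dAlem {n : ℕ} (ψ : ℝ × EuclideanSpace ℝ (Fin n) → ℝ)
    (p : ℝ × EuclideanSpace ℝ (Fin n)) : ℝ :=
  (∑ i, pdX i (pdX i ψ) p) - pdT (pdT ψ) p
/-- The decay condition of ψ at (t*, x*, λ): beyond some radius r*, for each m ∈ {0,1,2}
there are p_m > m and C_m > 0 bounding every pure m-th order partial derivative of ψ
(with respect to the time variable or a single space coordinate), evaluated along the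
biased argument, by C_m * ‖x - x*‖ ^ (-p_m). -/
def Decay {n : ℕ} (ψ : ℝ × EuclideanSpace ℝ (Fin n) → ℝ) (ts lam : ℝ)
    (xs : EuclideanSpace ℝ (Fin n)) : Prop :=
  ∃ rs : ℝ, 0 < rs ∧
    (∃ p C : ℝ, 0 < p ∧ 0 < C ∧ ∀ x, rs < ‖x - xs‖ →
      |ψ (ts + lam * ‖x - xs‖, x)| ≤ C * ‖x - xs‖ ^ (-p)) ∧
    (∃ p C : ℝ, 1 < p ∧ 0 < C ∧ ∀ x, rs < ‖x - xs‖ →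
      |pdT ψ (ts + lam * ‖x - xs‖, x)| ≤ C * ‖x - xs‖ ^ (-p) ∧
      ∀ i, |pdX i ψ (ts + lam * ‖x - xs‖, x)| ≤ C * ‖x - xs‖ ^ (-p)) ∧
    (∃ p C : ℝ, 2 < p ∧ 0 < C ∧ ∀ x, rs < ‖x - xs‖ →
      |pdT (pdT ψ) (ts + lam * ‖x - xs‖, x)| ≤ C * ‖x - xs‖ ^ (-p) ∧
      ∀ i, |pdX i (pdX i ψ) (ts + lam * ‖x - xs‖, x)| ≤ C * ‖x - xs‖ ^ (-p))
noncomputable def aCoef (n : ℕ) : ℝ :=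
  Real.Gamma ((n : ℝ) / 2) / (2 * ((n : ℝ) - 2) * Real.pi ^ ((n : ℝ) / 2))

lemma int_pd_zero {n : ℕ} (V : EuclideanSpace ℝ (Fin n) → ℝ) (i : Fin n) (hV : ContDiff ℝ 1 V)
    (hc : HasCompactSupport V) : Integrable (pd i V) ∧ ∫ x, pd i V x = 0 := by
  have hcont : Continuous (pd i V) := by
    unfold pd
    exact (hV.continuous_fderiv (by norm_num)).clm_apply continuous_const
  have hcs : HasCompactSupport (pd i V) := by
    have := hc.fderiv (𝕜 := ℝ)
    exact this.comp_left (g := fun L : EuclideanSpace ℝ (Fin n) →L[ℝ] ℝ => L (EuclideanSpace.single i 1)) (by simp)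
  have hi : Integrable (pd i V) := hcont.integrable_of_hasCompactSupport hcs
  have hVi : Integrable V := hV.continuous.integrable_of_hasCompactSupport hc
  refine ⟨hi, ?_⟩
  have := integral_mul_fderiv_eq_neg_fderiv_mul_of_integrable (μ := (volume : Measure (EuclideanSpace ℝ (Fin n)))) (𝕜 := ℝ)
    (f := fun _ => (1:ℝ)) (g := V) (v := EuclideanSpace.single i 1) (by simp) (by simp only [one_mul]; exact hi)
    (by simpa using hVi) (fun _ _ => differentiableAt_const _)
    (fun x _ => (hV.differentiable (by norm_num)).differentiableAt)
  simpa [pd] using this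

lemma pdT_eq {n : ℕ} {f : ℝ × EuclideanSpace ℝ (Fin n) → ℝ} (hf : Differentiable ℝ f) :
    pdT f = fun p => fderiv ℝ f p (1, 0) := by
  funext p
  have h1 : HasDerivAt (fun s : ℝ => (s, p.2)) ((1:ℝ), (0 : EuclideanSpace ℝ (Fin n))) p.1 :=
    (hasDerivAt_id p.1).prodMk (hasDerivAt_const _ _)
  exact ((hf (p.1, p.2)).hasFDerivAt.comp_hasDerivAt p.1 h1).deriv

lemma pdX_eq {n : ℕ} (i : Fin n) {f : ℝ × EuclideanSpace ℝ (Fin n) → ℝ} (hf : Differentiable ℝ f) :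
    pdX i f = fun p => fderiv ℝ f p (0, EuclideanSpace.single i 1) := by
  funext p
  have h1 := hasFDerivAt_prodMk_right (𝕜 := ℝ) p.1 p.2
  have := ((hf (p.1, p.2)).hasFDerivAt.comp p.2 h1).fderiv
  unfold pdX
  change fderiv ℝ (f ∘ fun y => (p.1, y)) p.2 _ = _
  rw [this]
  simp

lemma pdT_contDiff {n : ℕ} {f : ℝ × EuclideanSpace ℝ (Fin n) → ℝ} {k : ℕ}
    (hf : ContDiff ℝ (k+1 : ℕ) f) : ContDiff ℝ k (pdT f) := by
  rw [pdT_eq (hf.differentiable (by simp))]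
  exact (hf.fderiv_right (m := k) (by simp)).clm_apply contDiff_const

lemma pdX_contDiff {n : ℕ} (i : Fin n) {f : ℝ × EuclideanSpace ℝ (Fin n) → ℝ} {k : ℕ}
    (hf : ContDiff ℝ (k+1 : ℕ) f) : ContDiff ℝ k (pdX i f) := by
  rw [pdX_eq i (hf.differentiable (by simp))]
  exact (hf.fderiv_right (m := k) (by simp)).clm_apply contDiff_const

lemma pd_comm {n : ℕ} (i : Fin n) {f : ℝ × EuclideanSpace ℝ (Fin n) → ℝ}
    (hf : ContDiff ℝ 2 f) : pdT (pdX i f) = pdX i (pdT f) := by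
  have h1 : ContDiff ℝ (1:ℕ) (pdT f) := pdT_contDiff (k := 1) (by exact_mod_cast hf)
  have h2 : ContDiff ℝ (1:ℕ) (pdX i f) := pdX_contDiff (k := 1) i (by exact_mod_cast hf)
  have hd : Differentiable ℝ f := hf.differentiable (by norm_num)
  rw [pdT_eq (h2.differentiable (by simp)), pdX_eq i (h1.differentiable (by simp)), pdT_eq hd, pdX_eq i hd]
  have h3 : Differentiable ℝ (fderiv ℝ f) := (hf.fderiv_right (m := 1) (by norm_num)).differentiable (by norm_num)
  funext p
  have hs : IsSymmSndFDerivAt ℝ f p := hf.contDiffAt.isSymmSndFDerivAt (by simp)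
  rw [fderiv_clm_apply (h3 p) (differentiableAt_const _), fderiv_clm_apply (h3 p) (differentiableAt_const _)]
  simp
  exact hs _ _

lemma norm_line {n : ℕ} (i : Fin n) (x : EuclideanSpace ℝ (Fin n)) (hx : x ≠ 0) :
    HasDerivAt (fun s : ℝ => ‖x + s • EuclideanSpace.single i (1:ℝ)‖) (x i / ‖x‖) 0 := by
  have h1 : HasDerivAt (fun s : ℝ => x + s • EuclideanSpace.single i (1:ℝ)) (EuclideanSpace.single i (1:ℝ)) 0 := by
    simpa using ((hasDerivAt_id (0:ℝ)).smul_const (EuclideanSpace.single i (1:ℝ))).const_add x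
  have h2 := h1.norm_sq
  have hpos : ‖x‖ ≠ 0 := by simpa using hx
  have h3 := h2.sqrt (by simpa using hx)
  simp only [Real.sqrt_sq (norm_nonneg _)] at h3
  convert h3 using 1
  simp [EuclideanSpace.inner_single_right]
  field_simp

noncomputable def cc {n : ℕ} (ts lam : ℝ) (xs x : EuclideanSpace ℝ (Fin n)) :
    ℝ × EuclideanSpace ℝ (Fin n) := (ts + lam * ‖x‖, xs + x)

lemma cc_line {n : ℕ} (ts lam : ℝ) (xs : EuclideanSpace ℝ (Fin n)) (i : Fin n)
    {f : ℝ × EuclideanSpace ℝ (Fin n) → ℝ} (hf : Differentiable ℝ f)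
    (x : EuclideanSpace ℝ (Fin n)) (hx : x ≠ 0) :
    HasDerivAt (fun s : ℝ => f (cc ts lam xs (x + s • EuclideanSpace.single i (1:ℝ))))
      (pdX i f (cc ts lam xs x) + lam * (x i / ‖x‖) * pdT f (cc ts lam xs x)) 0 := by
  have h1 : HasDerivAt (fun s : ℝ => x + s • EuclideanSpace.single i (1:ℝ)) (EuclideanSpace.single i (1:ℝ)) 0 := by
    simpa using ((hasDerivAt_id (0:ℝ)).smul_const (EuclideanSpace.single i (1:ℝ))).const_add x
  have h2 : HasDerivAt (fun s : ℝ => cc ts lam xs (x + s • EuclideanSpace.single i (1:ℝ)))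
      (lam * (x i / ‖x‖), EuclideanSpace.single i (1:ℝ)) 0 :=
    (((norm_line i x hx).const_mul lam).const_add ts).prodMk (h1.const_add xs)
  have h3 := (hf (cc ts lam xs (x + (0:ℝ) • EuclideanSpace.single i (1:ℝ)))).hasFDerivAt.comp_hasDerivAt 0 h2
  have e : (lam * (x i / ‖x‖), EuclideanSpace.single i (1:ℝ)) =
    (lam * (x i / ‖x‖)) • ((1:ℝ), (0: EuclideanSpace ℝ (Fin n))) + (0, EuclideanSpace.single i (1:ℝ)) := by
    simp
  rw [e, map_add, map_smul] at h3
  rw [pdT_eq hf, pdX_eq i hf]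
  rw [zero_smul, add_zero, smul_eq_mul, add_comm] at h3
  exact h3

lemma cc_cont {n : ℕ} (ts lam : ℝ) (xs : EuclideanSpace ℝ (Fin n)) : Continuous (cc ts lam xs) := by
  unfold cc; fun_prop

lemma cc_contDiffAt {n : ℕ} (ts lam : ℝ) (xs x : EuclideanSpace ℝ (Fin n)) (hx : x ≠ 0) :
    ContDiffAt ℝ 1 (cc ts lam xs) x := by
  unfold cc
  exact (contDiffAt_const.add (contDiffAt_const.mul (contDiffAt_norm ℝ hx))).prodMk
    (contDiffAt_const.add contDiffAt_id)

lemma V_line {n : ℕ} (ts lam : ℝ) (xs : EuclideanSpace ℝ (Fin n)) (i : Fin n)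
    {ψ : ℝ × EuclideanSpace ℝ (Fin n) → ℝ} (hψ : ContDiff ℝ 2 ψ)
    (x : EuclideanSpace ℝ (Fin n)) (hx : x ≠ 0) (a b c : ℝ → ℝ) (a' b' c' : ℝ)
    (ha : HasDerivAt a a' ‖x‖) (hb : HasDerivAt b b' ‖x‖) (hc : HasDerivAt c c' ‖x‖)
    (V : EuclideanSpace ℝ (Fin n) → ℝ)
    (hV : ∀ x, V x = a ‖x‖ * pdX i ψ (cc ts lam xs x) +
      (b ‖x‖ * ψ (cc ts lam xs x) + c ‖x‖ * pdT ψ (cc ts lam xs x)) * x i)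
    (hVd : DifferentiableAt ℝ V x) :
    pd i V x = a' * (x i / ‖x‖) * pdX i ψ (cc ts lam xs x)
      + a ‖x‖ * (pdX i (pdX i ψ) (cc ts lam xs x) + lam * (x i / ‖x‖) * pdX i (pdT ψ) (cc ts lam xs x))
      + ((b' * (x i / ‖x‖) * ψ (cc ts lam xs x)
          + b ‖x‖ * (pdX i ψ (cc ts lam xs x) + lam * (x i / ‖x‖) * pdT ψ (cc ts lam xs x)))
        + (c' * (x i / ‖x‖) * pdT ψ (cc ts lam xs x)
          + c ‖x‖ * (pdX i (pdT ψ) (cc ts lam xs x) + lam * (x i / ‖x‖) * pdT (pdT ψ) (cc ts lam xs x)))) * x i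
      + (b ‖x‖ * ψ (cc ts lam xs x) + c ‖x‖ * pdT ψ (cc ts lam xs x)) := by
  have h1 : ContDiff ℝ (1:ℕ) (pdT ψ) := pdT_contDiff (k := 1) (by exact_mod_cast hψ)
  have h2 : ContDiff ℝ (1:ℕ) (pdX i ψ) := pdX_contDiff (k := 1) i (by exact_mod_cast hψ)
  have hd : Differentiable ℝ ψ := hψ.differentiable (by norm_num)
  have n0 : ‖x + (0:ℝ) • EuclideanSpace.single i (1:ℝ)‖ = ‖x‖ := by simp
  have nl := norm_line i x hx
  have A := (HasDerivAt.comp (0:ℝ) (by rw [n0]; exact ha) nl)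
  have B := (HasDerivAt.comp (0:ℝ) (by rw [n0]; exact hb) nl)
  have C := (HasDerivAt.comp (0:ℝ) (by rw [n0]; exact hc) nl)
  have X : HasDerivAt (fun s : ℝ => (x + s • EuclideanSpace.single i (1:ℝ)) i) 1 0 := by
    simpa using (hasDerivAt_id (0:ℝ)).const_add (x i)
  have F := cc_line ts lam xs i hd x hx
  have G := cc_line ts lam xs i (h1.differentiable (by simp)) x hx
  have P := cc_line ts lam xs i (h2.differentiable (by simp)) x hx
  have tot := (A.mul P).add (((B.mul F).add (C.mul G)).mul X)
  have e : pd i V x = lineDeriv ℝ V x (EuclideanSpace.single i 1) := (hVd.lineDeriv_eq_fderiv).symm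
  rw [e]
  have h5 : deriv (fun s : ℝ => V (x + s • EuclideanSpace.single i (1:ℝ))) 0 = _ :=
    (tot.congr_of_eventuallyEq (f₁ := fun s : ℝ => V (x + s • EuclideanSpace.single i (1:ℝ)))
      (Eventually.of_forall fun s => by simp only [hV]; rfl)).deriv
  unfold lineDeriv
  rw [h5, pd_comm i hψ]
  simp
  ring

lemma cda_zpow (k : ℤ) (r : ℝ) (hr : r ≠ 0) : ContDiffAt ℝ 1 (fun r : ℝ => r ^ k) r := by
  cases k with
  | ofNat m => simpa using contDiffAt_id.pow m
  | negSucc m =>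
    simp only [zpow_negSucc]
    exact (contDiffAt_id.pow (m+1)).inv (pow_ne_zero _ hr)

noncomputable def QQ {n : ℕ} (ψ : ℝ × EuclideanSpace ℝ (Fin n) → ℝ) (ts lam : ℝ)
    (xs x : EuclideanSpace ℝ (Fin n)) : ℝ :=
  (∑ i, x i * pdX i ψ (cc ts lam xs x)) + ((n:ℝ) - 2) * ψ (cc ts lam xs x)
    - lam * ‖x‖ * pdT ψ (cc ts lam xs x)

noncomputable def DD {n : ℕ} (ψ : ℝ × EuclideanSpace ℝ (Fin n) → ℝ) (ts lam : ℝ)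
    (xs x : EuclideanSpace ℝ (Fin n)) : ℝ :=
  ‖x‖ ^ (2 - (n:ℤ)) * dAlem ψ (cc ts lam xs x)
    + lam * ((n:ℝ) - 3) * (‖x‖ ^ (1 - (n:ℤ)) * pdT ψ (cc ts lam xs x))

lemma div_sum {n : ℕ} (ts lam : ℝ) (hl : lam ^ 2 = 1) (xs : EuclideanSpace ℝ (Fin n))
    {ψ : ℝ × EuclideanSpace ℝ (Fin n) → ℝ} (hψ : ContDiff ℝ 2 ψ)
    (x : EuclideanSpace ℝ (Fin n)) (hx : x ≠ 0) (K : ℝ → ℝ) (K' : ℝ)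
    (hK : HasDerivAt K K' ‖x‖)
    (V : Fin n → EuclideanSpace ℝ (Fin n) → ℝ)
    (hV : ∀ i x, V i x = (K ‖x‖ * ‖x‖ ^ (2 - (n:ℤ))) * pdX i ψ (cc ts lam xs x) +
      ((K ‖x‖ * (((n:ℝ) - 2) * ‖x‖ ^ (-(n:ℤ)))) * ψ (cc ts lam xs x)
        + (K ‖x‖ * (-lam * ‖x‖ ^ (1 - (n:ℤ)))) * pdT ψ (cc ts lam xs x)) * x i)
    (hVd : ∀ i, DifferentiableAt ℝ (V i) x) :
    ∑ i, pd i (V i) x = K ‖x‖ * DD ψ ts lam xs x + K' * (‖x‖ ^ (1 - (n:ℤ)) * QQ ψ ts lam xs x) := by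
  have hr : ‖x‖ ≠ 0 := by simpa using hx
  have z (k : ℤ) := hasDerivAt_zpow k ‖x‖ (Or.inl hr)
  have key := fun i => V_line ts lam xs i hψ x hx _ _ _ _ _ _ (hK.mul (z (2 - (n:ℤ))))
    (hK.mul ((z (-(n:ℤ))).const_mul ((n:ℝ) - 2))) (hK.mul ((z (1 - (n:ℤ))).const_mul (-lam)))
    (V i) (hV i) (hVd i)
  have hsq : ∑ i, x i * x i = ‖x‖ ^ 2 := by
    rw [EuclideanSpace.real_norm_sq_eq]; simp [pow_two]
  rw [Finset.sum_congr rfl (fun i _ => key i)]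
  have e1 : ‖x‖ ^ (1 - (n:ℤ)) = ‖x‖ * ‖x‖ ^ (-(n:ℤ)) := by
    rw [sub_eq_add_neg, zpow_add₀ hr, zpow_one]
  have e2 : ‖x‖ ^ (2 - (n:ℤ)) = ‖x‖ ^ 2 * ‖x‖ ^ (-(n:ℤ)) := by
    rw [sub_eq_add_neg, zpow_add₀ hr]; norm_cast
  have e3 : ‖x‖ ^ (-(n:ℤ) - 1) = ‖x‖ ^ (-(n:ℤ)) / ‖x‖ := by
    rw [zpow_sub₀ hr, zpow_one]
  have e4 : ‖x‖ ^ (2 - (n:ℤ) - 1) = ‖x‖ * ‖x‖ ^ (-(n:ℤ)) := by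
    rw [← e1]; congr 1; ring
  have e5 : ‖x‖ ^ (1 - (n:ℤ) - 1) = ‖x‖ ^ (-(n:ℤ)) := by
    congr 1; ring
  unfold DD QQ dAlem
  simp only [Pi.mul_apply, e1, e2, e3, e4, e5]
  generalize ‖x‖ ^ (-(n:ℤ)) = p at *
  generalize ‖x‖ = r at *
  generalize ψ (cc ts lam xs x) = φ
  generalize pdT ψ (cc ts lam xs x) = g
  generalize pdT (pdT ψ) (cc ts lam xs x) = T
  generalize K r = k
  push_cast
  trans ∑ i, (((K' * (r^2*p) + k * ((2 - n) * (r*p))) / r + k * ((n - 2) * p)) * (x i * pdX i ψ (cc ts lam xs x))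
     + (k * (r^2*p)) * pdX i (pdX i ψ) (cc ts lam xs x)
     + (((K' * ((n-2)*p) + k * ((n-2) * (-n * (p / r)))) * φ + k * ((n-2)*p) * lam * g
        + (K' * (-lam * (r * p)) + k * (-lam * ((1-n)*p))) * g
        + k * (-lam * (r*p)) * lam * T) / r) * (x i * x i)
     + (k * ((n-2)*p) * φ + k * (-lam * (r*p)) * g))
  · refine Finset.sum_congr rfl fun i _ => ?_
    field_simp
    ring
  · simp only [Finset.sum_add_distrib, ← Finset.mul_sum, hsq]
    simp only [Finset.sum_const, Finset.card_univ, Fintype.card_fin, nsmul_eq_mul]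
    generalize (∑ i, x i * pdX i ψ (cc ts lam xs x)) = S
    generalize (∑ i, pdX i (pdX i ψ) (cc ts lam xs x)) = L
    field_simp
    linear_combination (-(r^2 * p * k * T)) * hl

lemma div_int {n : ℕ} (hn : 0 < n) (ts lam : ℝ) (hl : lam ^ 2 = 1) (xs : EuclideanSpace ℝ (Fin n))
    {ψ : ℝ × EuclideanSpace ℝ (Fin n) → ℝ} (hψ : ContDiff ℝ 2 ψ)
    (K : ℝ → ℝ) (hK : ContDiff ℝ 1 K) (δ R : ℝ) (hδ : 0 < δ) (h0 : ∀ r ≤ δ, K r = 0)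
    (h1 : ∀ r, R ≤ r → K r = 0) :
    ∫ x, (K ‖x‖ * DD ψ ts lam xs x + deriv K ‖x‖ * (‖x‖ ^ (1 - (n:ℤ)) * QQ ψ ts lam xs x)) = 0 := by
  set V : Fin n → EuclideanSpace ℝ (Fin n) → ℝ := fun i x =>
    (K ‖x‖ * ‖x‖ ^ (2 - (n:ℤ))) * pdX i ψ (cc ts lam xs x) +
      ((K ‖x‖ * (((n:ℝ) - 2) * ‖x‖ ^ (-(n:ℤ)))) * ψ (cc ts lam xs x)
        + (K ‖x‖ * (-lam * ‖x‖ ^ (1 - (n:ℤ)))) * pdT ψ (cc ts lam xs x)) * x i with hV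
  have hT : ContDiff ℝ 1 (pdT ψ) := by
    exact_mod_cast pdT_contDiff (k := 1) (f := ψ) (by exact_mod_cast hψ)
  have hX : ∀ i, ContDiff ℝ 1 (pdX i ψ) := fun i => by
    exact_mod_cast pdX_contDiff (k := 1) (f := ψ) i (by exact_mod_cast hψ)
  have hc : ∀ i, ContDiff ℝ 1 (V i) := by
    intro i
    rw [contDiff_iff_contDiffAt]
    intro x
    by_cases hx : x = 0
    · have : V i =ᶠ[nhds x] fun _ => 0 := by
        filter_upwards [Metric.ball_mem_nhds x hδ] with y hy
        have : ‖y‖ < δ := by simpa [hx] using hy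
        simp [hV, h0 _ this.le]
      exact contDiffAt_const.congr_of_eventuallyEq this
    · have hr : ‖x‖ ≠ 0 := by simpa using hx
      have nn : ContDiffAt ℝ 1 (fun x : EuclideanSpace ℝ (Fin n) => ‖x‖) x := contDiffAt_norm ℝ hx
      have hz : ∀ k : ℤ, ContDiffAt ℝ 1 (fun x : EuclideanSpace ℝ (Fin n) => ‖x‖ ^ k) x := fun k =>
        ContDiffAt.comp x (cda_zpow k ‖x‖ hr) nn
      have hk : ContDiffAt ℝ 1 (fun x : EuclideanSpace ℝ (Fin n) => K ‖x‖) x :=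
        ContDiffAt.comp x hK.contDiffAt nn
      have c := cc_contDiffAt ts lam xs x hx
      have c1 : ContDiffAt ℝ 1 (fun x => ψ (cc ts lam xs x)) x :=
        ContDiffAt.comp x (hψ.of_le (by norm_num)).contDiffAt c
      have c2 : ContDiffAt ℝ 1 (fun x => pdT ψ (cc ts lam xs x)) x := ContDiffAt.comp x hT.contDiffAt c
      have c3 : ContDiffAt ℝ 1 (fun x => pdX i ψ (cc ts lam xs x)) x :=
        ContDiffAt.comp x (hX i).contDiffAt c
      have c4 : ContDiffAt ℝ 1 (fun x : EuclideanSpace ℝ (Fin n) => x i) x := by fun_prop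
      exact ((hk.mul (hz _)).mul c3).add ((((hk.mul (contDiffAt_const.mul (hz _))).mul c1).add
        ((hk.mul (contDiffAt_const.mul (hz _))).mul c2)).mul c4)
  have hs : ∀ i, HasCompactSupport (V i) := by
    intro i
    refine HasCompactSupport.of_support_subset_isCompact (isCompact_closedBall (0:EuclideanSpace ℝ (Fin n)) R) ?_
    intro x hx
    by_contra hh
    have : R < ‖x‖ := by simpa using hh
    exact hx (by simp [hV, h1 _ this.le])
  have hz := fun i => int_pd_zero (V i) i (hc i) (hs i)
  have h2 : ∫ x, ∑ i, pd i (V i) x = 0 := by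
    rw [integral_finsetSum _ (fun i _ => (hz i).1)]
    simp [(hz _).2]
  rw [← h2]
  have : Nonempty (Fin n) := ⟨⟨0, hn⟩⟩
  refine integral_congr_ae ?_
  have hne : ∀ᵐ x : EuclideanSpace ℝ (Fin n), x ≠ 0 := by
    simp [ae_iff]
  filter_upwards [hne] with x hx
  exact (div_sum ts lam hl xs hψ x hx K _ ((hK.differentiable (by norm_num)) ‖x‖).hasDerivAt V
    (fun i x => rfl) (fun i => (hc i).differentiable (by norm_num) x)).symm

lemma rad_int {n : ℕ} (hn : 0 < n) (k : ℕ) (hk : 1 ≤ k) (p C rs : ℝ) (hp : (k:ℝ) < p) (hrs : 0 < rs)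
    (f : EuclideanSpace ℝ (Fin n) → ℝ) (hf : Continuous f)
    (hb : ∀ x, rs < ‖x‖ → |f x| ≤ C * ‖x‖ ^ (-p)) :
    Integrable (fun x => ‖x‖ ^ ((k:ℤ) - n) * f x) := by
  have : Nonempty (Fin n) := ⟨⟨0, hn⟩⟩
  obtain ⟨M, hM⟩ := (isCompact_closedBall (0:EuclideanSpace ℝ (Fin n)) rs).exists_bound_of_continuousOn hf.continuousOn
  let G : ℝ → ℝ := fun r => if r ≤ rs then M * r ^ ((k:ℤ) - n) else C * r ^ ((k:ℤ)-n) * r ^ (-p)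
  have hG : Integrable (fun x : EuclideanSpace ℝ (Fin n) => G ‖x‖) := by
    rw [integrable_fun_norm_addHaar volume (f := G)]
    rw [← Set.Ioc_union_Ioi_eq_Ioi hrs.le, finrank_euclideanSpace_fin]
    have hpw : ∀ y : ℝ, 0 < y → y ^ (n-1) * y ^ ((k:ℤ)-n) = y ^ (k-1) := by
      intro y hy
      rw [← zpow_natCast, ← zpow_natCast, ← zpow_add₀ hy.ne']
      congr 1
      omega
    refine IntegrableOn.union ?_ ?_
    · have : IntegrableOn (fun y : ℝ => M * y ^ (k-1)) (Set.Ioc 0 rs) :=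
        (Continuous.integrableOn_Icc (by fun_prop)).mono_set Set.Ioc_subset_Icc_self
      refine this.congr_fun ?_ measurableSet_Ioc
      intro y hy
      simp only [G, if_pos hy.2, smul_eq_mul]
      rw [← hpw y hy.1]; ring
    · have : IntegrableOn (fun y : ℝ => C * y ^ ((k:ℝ)-1-p)) (Set.Ioi rs) :=
        (integrableOn_Ioi_rpow_of_lt (by linarith) hrs).const_mul C
      refine this.congr_fun ?_ measurableSet_Ioi
      intro y hy
      have hy0 : 0 < y := hrs.trans hy
      have hy' : ¬ y ≤ rs := not_le.mpr hy
      simp only [G, if_neg hy', smul_eq_mul]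
      have e : y ^ ((k:ℝ)-1-p) = y ^ (k-1) * y ^ (-p) := by
        rw [← Real.rpow_natCast, ← Real.rpow_add hy0]
        congr 1
        push_cast [hk]
        ring
      rw [e, ← hpw y hy0]; ring
  refine hG.mono' ?_ (Eventually.of_forall fun x => ?_)
  · exact ((measurable_norm.pow_const _).mul hf.measurable).aestronglyMeasurable
  · have hz : 0 ≤ ‖x‖ ^ ((k:ℤ) - n) := zpow_nonneg (norm_nonneg _) _
    rw [norm_mul, Real.norm_of_nonneg hz]
    by_cases h : ‖x‖ ≤ rs
    · simp only [G, if_pos h]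
      rw [mul_comm]
      exact mul_le_mul_of_nonneg_right (hM x (by simpa using h)) hz
    · simp only [G, if_neg h]
      have := mul_le_mul_of_nonneg_left (hb x (not_le.mp h)) hz
      rw [Real.norm_eq_abs]
      linarith

lemma dT_cont : Continuous (deriv Real.smoothTransition) :=
  (Real.smoothTransition.contDiff (n := 1)).continuous_deriv (by norm_num)

lemma dT_neg (s : ℝ) (hs : s < 0) : deriv Real.smoothTransition s = 0 := by
  have : Real.smoothTransition =ᶠ[nhds s] fun _ => 0 := by
    filter_upwards [Iio_mem_nhds hs] with y hy
    exact Real.smoothTransition.zero_of_nonpos (le_of_lt hy)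
  rw [this.deriv_eq]; simp

lemma dT_gt (s : ℝ) (hs : 1 < s) : deriv Real.smoothTransition s = 0 := by
  have : Real.smoothTransition =ᶠ[nhds s] fun _ => 1 := by
    filter_upwards [Ioi_mem_nhds hs] with y hy
    exact Real.smoothTransition.one_of_one_le (le_of_lt hy)
  rw [this.deriv_eq]; simp

noncomputable def ww (n : ℕ) (r : ℝ) : ℝ := deriv Real.smoothTransition (r - 1) * r ^ (1 - (n:ℤ))

lemma ww_int {n : ℕ} (hn : 0 < n) : Integrable (fun x : EuclideanSpace ℝ (Fin n) => ww n ‖x‖) ∧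
    ∫ x : EuclideanSpace ℝ (Fin n), ww n ‖x‖ =
      n * (volume : Measure (EuclideanSpace ℝ (Fin n))).real (Metric.ball 0 1) := by
  have : Nonempty (Fin n) := ⟨⟨0, hn⟩⟩
  have hpw : ∀ y ∈ Set.Ioi (0:ℝ), y ^ (n-1) * ww n y = deriv Real.smoothTransition (y - 1) := by
    intro y hy
    have hy : 0 < y := hy
    have : y ^ (n-1) * y ^ (1 - (n:ℤ)) = 1 := by
      rw [← zpow_natCast, ← zpow_add₀ hy.ne']
      have : ((n-1:ℕ):ℤ) + (1 - (n:ℤ)) = 0 := by omega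
      rw [this, zpow_zero]
    unfold ww
    linear_combination deriv Real.smoothTransition (y - 1) * this
  have hI : Integrable (fun y : ℝ => deriv Real.smoothTransition (y - 1)) := by
    refine (dT_cont.comp (continuous_id.sub continuous_const)).integrable_of_hasCompactSupport ?_
    refine HasCompactSupport.of_support_subset_isCompact (isCompact_Icc (a := (1:ℝ)) (b := 2)) ?_
    intro y hy
    by_contra h
    rw [Set.mem_Icc, not_and_or, not_le, not_le] at h
    rcases h with h | h
    · exact hy (dT_neg _ (by simp; linarith))
    · exact hy (dT_gt _ (by simp; linarith))
  constructor
  · rw [integrable_fun_norm_addHaar volume (f := ww n), finrank_euclideanSpace_fin]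
    exact hI.integrableOn.congr_fun (fun y hy => (hpw y hy).symm) measurableSet_Ioi
  · rw [integral_fun_norm_addHaar volume (ww n), finrank_euclideanSpace_fin]
    simp only [smul_eq_mul]
    rw [setIntegral_congr_fun measurableSet_Ioi hpw]
    rw [integral_Ioi_of_hasDerivAt_of_tendsto' (f := fun y => Real.smoothTransition (y - 1)) (m := 1)]
    · rw [Real.smoothTransition.zero_of_nonpos (by norm_num)]
      simp
    · intro y _
      have hd : DifferentiableAt ℝ Real.smoothTransition (y - 1) :=
        (Real.smoothTransition.contDiff (n := 1)).differentiable (by norm_num) _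
      exact hd.hasDerivAt.comp_sub_const y 1
    · exact hI.integrableOn
    · refine tendsto_const_nhds.congr' ?_
      filter_upwards [eventually_ge_atTop 2] with y hy
      rw [Real.smoothTransition.one_of_one_le (by linarith)]

noncomputable def kk (δ r : ℝ) : ℝ := Real.smoothTransition (r / δ - 1)

lemma kk_deriv (δ r : ℝ) : HasDerivAt (kk δ) (deriv Real.smoothTransition (r / δ - 1) * δ⁻¹) r := by
  have hd : DifferentiableAt ℝ Real.smoothTransition (r / δ - 1) :=
    (Real.smoothTransition.contDiff (n := 1)).differentiable (by norm_num) _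
  have h : HasDerivAt (fun r : ℝ => r / δ - 1) (δ⁻¹) r := by
    simpa using ((hasDerivAt_id r).div_const δ).sub_const 1
  exact hd.hasDerivAt.comp r h

lemma J_eq {n : ℕ} (hn : 0 < n) (Q : EuclideanSpace ℝ (Fin n) → ℝ) (hQ : Continuous Q) (M : ℝ)
    (hM : ∀ x, ‖Q x‖ ≤ M) (δ : ℝ) (hδ : 0 < δ) :
    Integrable (fun x => deriv (kk δ) ‖x‖ * (‖x‖ ^ (1 - (n:ℤ)) * Q x)) ∧
    ∫ x, deriv (kk δ) ‖x‖ * (‖x‖ ^ (1 - (n:ℤ)) * Q x) = ∫ x, ww n ‖x‖ * Q (δ • x) := by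
  set f : EuclideanSpace ℝ (Fin n) → ℝ := fun x => deriv (kk δ) ‖x‖ * (‖x‖ ^ (1 - (n:ℤ)) * Q x) with hf
  have key : ∀ x, f (δ • x) = (δ ^ n)⁻¹ * (ww n ‖x‖ * Q (δ • x)) := by
    intro x
    simp only [hf, (kk_deriv _ _).deriv, norm_smul, Real.norm_of_nonneg hδ.le, ww]
    rw [mul_div_cancel_left₀ _ hδ.ne', mul_zpow]
    have : δ⁻¹ * δ ^ (1 - (n:ℤ)) = (δ ^ n)⁻¹ := by
      rw [← zpow_neg_one, ← zpow_add₀ hδ.ne', ← zpow_natCast, ← zpow_neg]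
      congr 1; ring
    rw [← this]; ring
  have hi : Integrable (fun x => ww n ‖x‖ * Q (δ • x)) := by
    refine (ww_int hn).1.mul_bdd (c := M) ?_ ?_
    · exact (hQ.comp (continuous_const_smul δ)).aestronglyMeasurable
    · exact Eventually.of_forall fun x => hM _
  constructor
  · rw [← integrable_comp_smul_iff volume f hδ.ne']
    simp only [key]
    exact hi.const_mul _
  · have := Measure.integral_comp_smul volume f δ
    simp only [key] at this
    rw [integral_const_mul, finrank_euclideanSpace_fin, abs_of_pos (by positivity), smul_eq_mul] at this
    exact (mul_left_cancel₀ (by positivity) this).symm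

lemma J_lim0 {n : ℕ} (hn : 0 < n) (Q : EuclideanSpace ℝ (Fin n) → ℝ) (hQ : Continuous Q) (M : ℝ)
    (hM : ∀ x, ‖Q x‖ ≤ M) :
    Tendsto (fun δ : ℝ => ∫ x, ww n ‖x‖ * Q (δ • x)) (nhdsWithin 0 (Set.Ioi 0))
      (nhds (n * (volume : Measure (EuclideanSpace ℝ (Fin n))).real (Metric.ball 0 1) * Q 0)) := by
  rw [← (ww_int hn).2, ← integral_mul_const]
  refine tendsto_integral_filter_of_dominated_convergence (fun x => ‖ww n ‖x‖‖ * M) ?_ ?_ ?_ ?_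
  · exact Eventually.of_forall fun δ => (ww_int hn).1.aestronglyMeasurable.mul
      (hQ.comp (continuous_const_smul δ)).aestronglyMeasurable
  · refine Eventually.of_forall fun δ => Eventually.of_forall fun x => ?_
    rw [norm_mul]
    exact mul_le_mul_of_nonneg_left (hM _) (norm_nonneg _)
  · exact (ww_int hn).1.norm.mul_const M
  · refine Eventually.of_forall fun x => Tendsto.const_mul _ ?_
    have : Continuous (fun δ : ℝ => Q (δ • x)) := by fun_prop
    have h := this.tendsto 0
    rw [zero_smul] at h
    exact h.mono_left nhdsWithin_le_nhds

lemma J_lim1 {n : ℕ} (hn : 0 < n) (Q : EuclideanSpace ℝ (Fin n) → ℝ) (hQ : Continuous Q) (M : ℝ)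
    (hM : ∀ x, ‖Q x‖ ≤ M) (hinf : Tendsto Q (cocompact _) (nhds 0)) :
    Tendsto (fun δ : ℝ => ∫ x, ww n ‖x‖ * Q (δ • x)) atTop (nhds 0) := by
  have : Nonempty (Fin n) := ⟨⟨0, hn⟩⟩
  have e : (0:ℝ) = ∫ x : EuclideanSpace ℝ (Fin n), (0:ℝ) := by simp
  rw [e]
  refine tendsto_integral_filter_of_dominated_convergence (fun x => ‖ww n ‖x‖‖ * M) ?_ ?_ ?_ ?_
  · exact Eventually.of_forall fun δ => (ww_int hn).1.aestronglyMeasurable.mul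
      (hQ.comp (continuous_const_smul δ)).aestronglyMeasurable
  · refine Eventually.of_forall fun δ => Eventually.of_forall fun x => ?_
    rw [norm_mul]
    exact mul_le_mul_of_nonneg_left (hM _) (norm_nonneg _)
  · exact (ww_int hn).1.norm.mul_const M
  · have hne : ∀ᵐ x : EuclideanSpace ℝ (Fin n), x ≠ 0 := by
      simp [ae_iff]
    filter_upwards [hne] with x hx
    rw [← mul_zero (ww n ‖x‖)]
    refine Tendsto.const_mul _ (hinf.comp ?_)
    rw [← Metric.cobounded_eq_cocompact, ← tendsto_norm_atTop_iff_cobounded]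
    simp only [norm_smul]
    exact (tendsto_norm_atTop_atTop).atTop_mul_const (norm_pos_iff.mpr hx)

lemma aCoef_eq {n : ℕ} (hn : 3 ≤ n) :
    aCoef n * (n * (volume : Measure (EuclideanSpace ℝ (Fin n))).real (Metric.ball 0 1) * ((n:ℝ)-2)) = 1 := by
  have : Nonempty (Fin n) := ⟨⟨0, by omega⟩⟩
  have hn' : (3:ℝ) ≤ n := by exact_mod_cast hn
  have hG : 0 < Real.Gamma ((n:ℝ)/2) := Real.Gamma_pos_of_pos (by positivity)
  have h2 : (n:ℝ) - 2 ≠ 0 := by linarith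
  have hp : √π ^ n = π ^ ((n:ℝ)/2) := by
    rw [Real.sqrt_eq_rpow, ← Real.rpow_natCast, ← Real.rpow_mul Real.pi_pos.le]
    congr 1; ring
  have hpp : 0 < π ^ ((n:ℝ)/2) := Real.rpow_pos_of_pos Real.pi_pos _
  rw [Measure.real, EuclideanSpace.volume_ball]
  simp only [Fintype.card_fin, ENNReal.ofReal_one, one_pow, one_mul, hp]
  have hG2 : Real.Gamma ((n:ℝ)/2 + 1) = (n:ℝ)/2 * Real.Gamma ((n:ℝ)/2) :=
    Real.Gamma_add_one (by positivity)
  rw [ENNReal.toReal_ofReal (by rw [hG2]; positivity), hG2, aCoef]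
  field_simp

lemma QQ_props {n : ℕ} (lam : ℝ) (hlam : lam = -1 ∨ lam = 1)
    (ts : ℝ) (xs : EuclideanSpace ℝ (Fin n))
    (ψ : ℝ × EuclideanSpace ℝ (Fin n) → ℝ) (hψ : ContDiff ℝ 2 ψ)
    (hdecay : Decay ψ ts lam xs) : Continuous (QQ ψ ts lam xs) ∧
      Tendsto (QQ ψ ts lam xs) (cocompact _) (nhds 0) := by
  have hcc := cc_cont ts lam xs
  have hT : Continuous (pdT ψ) := (pdT_contDiff (k := 1) (f := ψ) (by exact_mod_cast hψ)).continuous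
  have hX : ∀ i, Continuous (pdX i ψ) := fun i =>
    (pdX_contDiff (k := 1) (f := ψ) i (by exact_mod_cast hψ)).continuous
  have hψc := hψ.continuous
  constructor
  · unfold QQ
    fun_prop
  · obtain ⟨rs, hrs, ⟨p0, C0, hp0, hC0, h0⟩, ⟨p1, C1, hp1, hC1, h1⟩, -⟩ := hdecay
    have hl : |lam| = 1 := by rcases hlam with h | h <;> simp [h]
    have hsh : ∀ x, cc ts lam xs x = (ts + lam * ‖(xs + x) - xs‖, xs + x) := fun x => by simp [cc]
    have hb : ∀ x, rs < ‖x‖ → ‖QQ ψ ts lam xs x‖ ≤ ((n:ℝ) + 1) * C1 * ‖x‖ ^ (-(p1 - 1))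
        + |(n:ℝ) - 2| * C0 * ‖x‖ ^ (-p0) := by
      intro x hx
      have hxp : 0 < ‖x‖ := hrs.trans hx
      have a0 := h0 (xs + x) (by simpa using hx)
      have a1 := h1 (xs + x) (by simpa using hx)
      rw [← hsh] at a0 a1
      simp only [add_sub_cancel_left] at a0 a1
      have e : ‖x‖ ^ (-(p1 - 1)) = ‖x‖ * ‖x‖ ^ (-p1) := by
        rw [neg_sub, sub_eq_add_neg, Real.rpow_add hxp, Real.rpow_one]
      rw [e]
      unfold QQ
      have b1 : |∑ i, x i * pdX i ψ (cc ts lam xs x)| ≤ n * (‖x‖ * (C1 * ‖x‖ ^ (-p1))) := by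
        refine (Finset.abs_sum_le_sum_abs _ _).trans ?_
        have : ∀ i ∈ Finset.univ, |x i * pdX i ψ (cc ts lam xs x)| ≤ ‖x‖ * (C1 * ‖x‖ ^ (-p1)) := by
          intro i _
          rw [abs_mul]
          have hxi : |x i| ≤ ‖x‖ := by simpa using PiLp.norm_apply_le x i
          exact mul_le_mul hxi (a1.2 i) (abs_nonneg _) hxp.le
        simpa using Finset.sum_le_card_nsmul _ _ _ this
      have b2 : |((n:ℝ) - 2) * ψ (cc ts lam xs x)| ≤ |(n:ℝ) - 2| * (C0 * ‖x‖ ^ (-p0)) := by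
        rw [abs_mul]
        exact mul_le_mul_of_nonneg_left a0 (abs_nonneg _)
      have b3 : |lam * ‖x‖ * pdT ψ (cc ts lam xs x)| ≤ ‖x‖ * (C1 * ‖x‖ ^ (-p1)) := by
        rw [abs_mul, abs_mul, hl, one_mul, abs_norm]
        exact mul_le_mul_of_nonneg_left a1.1 hxp.le
      rw [Real.norm_eq_abs]
      have := (abs_sub ((∑ i, x i * pdX i ψ (cc ts lam xs x)) + ((n:ℝ) - 2) * ψ (cc ts lam xs x)) (lam * ‖x‖ * pdT ψ (cc ts lam xs x))).trans
        (add_le_add_left (abs_add_le _ _) _)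
      linarith
    have hlim : Tendsto (fun r : ℝ => ((n:ℝ) + 1) * C1 * r ^ (-(p1 - 1))
        + |(n:ℝ) - 2| * C0 * r ^ (-p0)) atTop (nhds 0) := by
      have := ((tendsto_rpow_neg_atTop (y := p1 - 1) (by linarith)).const_mul (((n:ℝ) + 1) * C1)).add
        ((tendsto_rpow_neg_atTop hp0).const_mul (|(n:ℝ) - 2| * C0))
      simpa using this
    have hno := tendsto_norm_cocompact_atTop (E := EuclideanSpace ℝ (Fin n))
    refine squeeze_zero_norm' ?_ (hlim.comp hno)
    filter_upwards [hno.eventually_gt_atTop rs] with x hx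
    exact hb x hx

theorem stmt_15 (n : ℕ) (hn : 3 ≤ n) (lam : ℝ) (hlam : lam = -1 ∨ lam = 1)
    (ts : ℝ) (xs : EuclideanSpace ℝ (Fin n))
    (ψ : ℝ × EuclideanSpace ℝ (Fin n) → ℝ) (hψ : ContDiff ℝ 2 ψ)
    (hdecay : Decay ψ ts lam xs) :
    Integrable (fun x : EuclideanSpace ℝ (Fin n) =>
      ‖x - xs‖ ^ (2 - (n : ℤ)) * dAlem ψ (ts + lam * ‖x - xs‖, x)) ∧
    Integrable (fun x : EuclideanSpace ℝ (Fin n) =>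
      ‖x - xs‖ ^ (1 - (n : ℤ)) * pdT ψ (ts + lam * ‖x - xs‖, x)) ∧
    ψ (ts, xs)
      = -(aCoef n) * (∫ x : EuclideanSpace ℝ (Fin n),
            ‖x - xs‖ ^ (2 - (n : ℤ)) * dAlem ψ (ts + lam * ‖x - xs‖, x))
        - lam * ((n : ℝ) - 3) * aCoef n * (∫ x : EuclideanSpace ℝ (Fin n),
            ‖x - xs‖ ^ (1 - (n : ℤ)) * pdT ψ (ts + lam * ‖x - xs‖, x)) := by
  have hn0 : 0 < n := by omega
  have hl2 : lam ^ 2 = 1 := by rcases hlam with h | h <;> simp [h]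
  have hcc := cc_cont ts lam xs
  have hT1 : ContDiff ℝ (1:ℕ) (pdT ψ) := pdT_contDiff (k := 1) (f := ψ) (by exact_mod_cast hψ)
  have hX1 : ∀ i, ContDiff ℝ (1:ℕ) (pdX i ψ) := fun i =>
    pdX_contDiff (k := 1) (f := ψ) i (by exact_mod_cast hψ)
  have hT : Continuous (pdT ψ) := hT1.continuous
  have hTT : Continuous (pdT (pdT ψ)) := (pdT_contDiff (k := 0) hT1).continuous
  have hXX : ∀ i, Continuous (pdX i (pdX i ψ)) := fun i => (pdX_contDiff (k := 0) i (hX1 i)).continuous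
  obtain ⟨hQc, hQ0⟩ := QQ_props lam hlam ts xs ψ hψ hdecay
  obtain ⟨rs, hrs, -, ⟨p1, C1, hp1, hC1, h1⟩, ⟨p2, C2, hp2, hC2, h2⟩⟩ := hdecay
  have hsh : ∀ x, cc ts lam xs x = (ts + lam * ‖(xs + x) - xs‖, xs + x) := fun x => by simp [cc]
  -- shifted functions
  have e1 : (fun x : EuclideanSpace ℝ (Fin n) =>
      ‖x - xs‖ ^ (2 - (n : ℤ)) * dAlem ψ (ts + lam * ‖x - xs‖, x)) =
      fun x => (fun y => ‖y‖ ^ (2 - (n:ℤ)) * dAlem ψ (cc ts lam xs y)) (x - xs) := by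
    funext x; simp [cc]
  have e2 : (fun x : EuclideanSpace ℝ (Fin n) =>
      ‖x - xs‖ ^ (1 - (n : ℤ)) * pdT ψ (ts + lam * ‖x - xs‖, x)) =
      fun x => (fun y => ‖y‖ ^ (1 - (n:ℤ)) * pdT ψ (cc ts lam xs y)) (x - xs) := by
    funext x; simp [cc]
  have i1 : Integrable (fun y => ‖y‖ ^ (2 - (n:ℤ)) * dAlem ψ (cc ts lam xs y)) := by
    have := rad_int hn0 2 (by norm_num) p2 (((n:ℝ) + 1) * C2) rs (by exact_mod_cast hp2) hrs
      (fun y => dAlem ψ (cc ts lam xs y)) (by unfold dAlem; fun_prop) (by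
        intro x hx
        have a1 := h2 (xs + x) (by simpa using hx)
        rw [← hsh] at a1
        simp only [add_sub_cancel_left] at a1
        have b1 : |∑ i, pdX i (pdX i ψ) (cc ts lam xs x)| ≤ n * (C2 * ‖x‖ ^ (-p2)) := by
          refine (Finset.abs_sum_le_sum_abs _ _).trans ?_
          simpa using Finset.sum_le_card_nsmul Finset.univ _ _ (fun i _ => a1.2 i)
        unfold dAlem
        have := abs_sub (∑ i, pdX i (pdX i ψ) (cc ts lam xs x)) (pdT (pdT ψ) (cc ts lam xs x))
        linarith [a1.1])
    exact_mod_cast this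
  have i2 : Integrable (fun y => ‖y‖ ^ (1 - (n:ℤ)) * pdT ψ (cc ts lam xs y)) := by
    have := rad_int hn0 1 (by norm_num) p1 C1 rs (by exact_mod_cast hp1) hrs
      (fun y => pdT ψ (cc ts lam xs y)) (by fun_prop) (by
        intro x hx
        have a1 := h1 (xs + x) (by simpa using hx)
        rw [← hsh] at a1
        simp only [add_sub_cancel_left] at a1
        exact a1.1)
    exact_mod_cast this
  rw [e1, e2]
  refine ⟨i1.comp_sub_right xs, i2.comp_sub_right xs, ?_⟩
  rw [integral_sub_right_eq_self (fun y => ‖y‖ ^ (2 - (n:ℤ)) * dAlem ψ (cc ts lam xs y)) xs,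
    integral_sub_right_eq_self (fun y => ‖y‖ ^ (1 - (n:ℤ)) * pdT ψ (cc ts lam xs y)) xs]
  have iD : Integrable (DD ψ ts lam xs) := i1.add (i2.const_mul (lam * ((n:ℝ) - 3)))
  have sD : ∫ x, DD ψ ts lam xs x = (∫ y, ‖y‖ ^ (2 - (n:ℤ)) * dAlem ψ (cc ts lam xs y))
      + lam * ((n:ℝ) - 3) * ∫ y, ‖y‖ ^ (1 - (n:ℤ)) * pdT ψ (cc ts lam xs y) := by
    rw [← integral_const_mul, ← integral_add i1 (i2.const_mul (lam * ((n:ℝ) - 3)))]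
    rfl
  -- bound on Q
  obtain ⟨M, hM⟩ : ∃ M, ∀ x, ‖QQ ψ ts lam xs x‖ ≤ M := by
    let f : ZeroAtInftyContinuousMap (EuclideanSpace ℝ (Fin n)) ℝ := ⟨⟨_, hQc⟩, hQ0⟩
    exact ⟨‖f.toBCF‖, fun x => f.toBCF.norm_coe_le_norm x⟩
  set J : ℝ → ℝ := fun δ => ∫ x, ww n ‖x‖ * QQ ψ ts lam xs (δ • x) with hJ
  set I : ℝ → ℝ := fun δ => ∫ x, (kk δ ‖x‖ - kk δ⁻¹ ‖x‖) * DD ψ ts lam xs x with hI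
  have kc : ∀ δ, ContDiff ℝ 1 (kk δ) := fun δ => by
    unfold kk
    exact (Real.smoothTransition.contDiff (n := 1)).comp ((contDiff_id.div_const δ).sub contDiff_const)
  have main : ∀ δ : ℝ, 0 < δ → δ < 1 → I δ = -(J δ - J δ⁻¹) := by
    intro δ h0 h1
    have hi0 : 0 < δ⁻¹ := by positivity
    have hi1 : 1 < δ⁻¹ := (one_lt_inv₀ h0).mpr h1
    have key := div_int hn0 ts lam hl2 xs hψ (fun r => kk δ r - kk δ⁻¹ r) ((kc _).sub (kc _)) δ
      (2 * δ⁻¹) h0 (by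
        intro r hr
        unfold kk
        rw [Real.smoothTransition.zero_of_nonpos, Real.smoothTransition.zero_of_nonpos, sub_zero]
        · rw [sub_nonpos, div_le_one hi0]; linarith
        · rw [sub_nonpos, div_le_one h0]; linarith) (by
        intro r hr
        unfold kk
        rw [Real.smoothTransition.one_of_one_le, Real.smoothTransition.one_of_one_le, sub_self]
        · rw [le_sub_iff_add_le, le_div_iff₀ hi0]; linarith
        · rw [le_sub_iff_add_le, le_div_iff₀ h0]; linarith)
    obtain ⟨j1, j2⟩ := J_eq hn0 _ hQc M hM δ h0
    obtain ⟨j3, j4⟩ := J_eq hn0 _ hQc M hM δ⁻¹ hi0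
    have hd : ∀ r, deriv (fun r => kk δ r - kk δ⁻¹ r) r = deriv (kk δ) r - deriv (kk δ⁻¹) r := fun r =>
      ((kk_deriv δ r).differentiableAt.hasDerivAt.sub (kk_deriv δ⁻¹ r).differentiableAt.hasDerivAt).deriv
    simp only [hd, sub_mul (deriv (kk δ) _)] at key
    rw [integral_add, integral_sub j1 j3, j2, j4] at key
    · simp only [hI, hJ]; linarith
    · refine iD.bdd_mul (c := 1) ?_ ?_
      · exact (((kc δ).continuous.comp continuous_norm).sub
          ((kc δ⁻¹).continuous.comp continuous_norm)).aestronglyMeasurable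
      · refine Eventually.of_forall fun x => ?_
        rw [Real.norm_eq_abs, abs_le]
        unfold kk
        constructor <;> linarith [Real.smoothTransition.nonneg (‖x‖ / δ - 1),
          Real.smoothTransition.le_one (‖x‖ / δ - 1), Real.smoothTransition.nonneg (‖x‖ / δ⁻¹ - 1),
          Real.smoothTransition.le_one (‖x‖ / δ⁻¹ - 1)]
    · exact j1.sub j3
  have : Nonempty (Fin n) := ⟨⟨0, hn0⟩⟩
  have limI : Tendsto I (nhdsWithin 0 (Set.Ioi 0)) (nhds (∫ x, DD ψ ts lam xs x)) := by
    refine tendsto_integral_filter_of_dominated_convergence (fun x => ‖DD ψ ts lam xs x‖) ?_ ?_ iD.norm ?_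
    · exact Eventually.of_forall fun δ => (((kc δ).continuous.comp continuous_norm).sub
          ((kc δ⁻¹).continuous.comp continuous_norm)).aestronglyMeasurable.mul iD.aestronglyMeasurable
    · refine Eventually.of_forall fun δ => Eventually.of_forall fun x => ?_
      rw [norm_mul]
      refine mul_le_of_le_one_left (norm_nonneg _) ?_
      rw [Real.norm_eq_abs, abs_le]
      unfold kk
      constructor <;> linarith [Real.smoothTransition.nonneg (‖x‖ / δ - 1),
          Real.smoothTransition.le_one (‖x‖ / δ - 1), Real.smoothTransition.nonneg (‖x‖ / δ⁻¹ - 1),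
          Real.smoothTransition.le_one (‖x‖ / δ⁻¹ - 1)]
    · have hne : ∀ᵐ x : EuclideanSpace ℝ (Fin n), x ≠ 0 := by
        simp [ae_iff]
      filter_upwards [hne] with x hx
      have hxp : 0 < ‖x‖ := norm_pos_iff.mpr hx
      refine tendsto_const_nhds.congr' ?_
      have s1 : ∀ᶠ δ : ℝ in nhdsWithin 0 (Set.Ioi 0), δ < ‖x‖ / 2 :=
        nhdsWithin_le_nhds (Iio_mem_nhds (by positivity))
      have s2 : ∀ᶠ δ : ℝ in nhdsWithin 0 (Set.Ioi 0), δ < ‖x‖⁻¹ :=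
        nhdsWithin_le_nhds (Iio_mem_nhds (by positivity))
      filter_upwards [s1, s2, self_mem_nhdsWithin] with δ hd1 hd2 hd0
      have hd0 : 0 < δ := hd0
      unfold kk
      rw [Real.smoothTransition.one_of_one_le, Real.smoothTransition.zero_of_nonpos]
      · ring
      · rw [div_inv_eq_mul]
        have := mul_lt_mul_of_pos_left hd2 hxp
        rw [mul_inv_cancel₀ hxp.ne'] at this
        linarith
      · rw [le_sub_iff_add_le, le_div_iff₀ hd0]; linarith
  have limJ := (J_lim0 hn0 _ hQc M hM).sub ((J_lim1 hn0 _ hQc M hM hQ0).comp tendsto_inv_nhdsGT_zero)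
  have fin : ∫ x, DD ψ ts lam xs x =
      -((n * (volume : Measure (EuclideanSpace ℝ (Fin n))).real (Metric.ball 0 1) * QQ ψ ts lam xs 0) - 0) := by
    refine tendsto_nhds_unique limI (limJ.neg.congr' ?_)
    have s1 : ∀ᶠ δ : ℝ in nhdsWithin 0 (Set.Ioi 0), δ < 1 :=
      nhdsWithin_le_nhds (Iio_mem_nhds (by positivity))
    filter_upwards [s1, self_mem_nhdsWithin] with δ hd1 hd0
    exact (main δ hd0 hd1).symm
  have hQ00 : QQ ψ ts lam xs 0 = ((n:ℝ) - 2) * ψ (ts, xs) := by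
    simp [QQ, cc]
  rw [hQ00, sD] at fin
  have ha := aCoef_eq hn
  linear_combination (aCoef n) * fin - ψ (ts, xs) * ha
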